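/- Let f : ℝ → ℂ, let c₁, c₂ ∈ ℂ, s₁, s₂ ∈ ℝ, C > 0 and k₀ > 0, and assume |f(k) − c₁·exp(i k s₁)| ≤ C/k and |f(k) − c₂·exp(i k s₂)| ≤ C/k for all k ≥ k₀. If c₁ ≠ 0, then s₁ = s₂ and c₁ = c₂. -/

import Mathlib

open Filter Topology in
/-- Part 1 of Theorem 3.2 in abstract form: the phase `s` and the nonzero amplitude `c`
in a high-frequency asymptotic `f k = c·e^{iks} + O(1/k)` are uniquely determined. -/
theorem stmt_2 (f : ℝ → ℂ) (c₁ c₂ : ℂ) (s₁ s₂ C k₀ : ℝ) (hC : 0 < C) (hk₀ : 0 < k₀)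
    (h₁ : ∀ k : ℝ, k₀ ≤ k → ‖f k - c₁ * Complex.exp (Complex.I * k * s₁)‖ ≤ C / k)
    (h₂ : ∀ k : ℝ, k₀ ≤ k → ‖f k - c₂ * Complex.exp (Complex.I * k * s₂)‖ ≤ C / k)
    (hc : c₁ ≠ 0) :
    s₁ = s₂ ∧ c₁ = c₂ := by
  have hb : ∀ k : ℝ, k₀ ≤ k →
      ‖c₁ - c₂ * Complex.exp (Complex.I * k * (s₂ - s₁))‖ ≤ C / k + C / k := by
    intro k hk
    have e1 : ‖Complex.exp (Complex.I * k * s₁)‖ = 1 := by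
      have := Complex.norm_exp_ofReal_mul_I (k * s₁)
      rw [← this]; congr 2; push_cast; ring
    have e2 : Complex.exp (Complex.I * k * s₂) =
        Complex.exp (Complex.I * k * (s₂ - s₁)) * Complex.exp (Complex.I * k * s₁) := by
      rw [← Complex.exp_add]; congr 1; ring
    have e3 : ‖c₁ - c₂ * Complex.exp (Complex.I * k * (s₂ - s₁))‖ =
        ‖(f k - c₂ * Complex.exp (Complex.I * k * s₂)) -
          (f k - c₁ * Complex.exp (Complex.I * k * s₁))‖ := by
      rw [← mul_one ‖c₁ - _‖, ← e1, ← norm_mul, e2]; congr 1; ring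
    rw [e3]
    exact (norm_sub_le _ _).trans (add_le_add (h₂ k hk) (h₁ k hk))
  have hl : Tendsto (fun k : ℝ => c₁ - c₂ * Complex.exp (Complex.I * k * (s₂ - s₁)))
      atTop (𝓝 0) := by
    refine squeeze_zero_norm' (a := fun k : ℝ => C / k + C / k) ?_ ?_
    · filter_upwards [eventually_ge_atTop k₀] with k hk using hb k hk
    · have h : Tendsto (fun k : ℝ => C / k) atTop (𝓝 0) := tendsto_const_nhds.div_atTop tendsto_id
      simpa using h.add h
  have hs : s₁ = s₂ := by
    by_contra hne
    have ht : (s₂ : ℂ) - s₁ ≠ 0 := by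
      rw [sub_ne_zero]; exact_mod_cast Ne.symm hne
    have h2 := hl.add (hl.comp (tendsto_atTop_add_const_right atTop (Real.pi / (s₂ - s₁)) tendsto_id))
    have h3 : Tendsto (fun _ : ℝ => 2 * c₁) atTop (𝓝 (0 + 0)) := by
      refine h2.congr fun k => ?_
      have : Complex.exp (Complex.I * ((k + Real.pi / (s₂ - s₁) : ℝ) : ℂ) * (s₂ - s₁)) =
          - Complex.exp (Complex.I * k * (s₂ - s₁)) := by
        rw [← Complex.exp_add_pi_mul_I]; congr 1; push_cast; field_simp
      simp only [Function.comp, id]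
      rw [this]; ring
    have := tendsto_nhds_unique h3 tendsto_const_nhds
    simp at this
    exact hc this
  refine ⟨hs, ?_⟩
  subst hs
  simp only [sub_self, mul_zero, Complex.exp_zero, mul_one] at hl
  exact sub_eq_zero.mp (tendsto_nhds_unique tendsto_const_nhds hl)
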